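/- arXiv:2308.10711 — 2 statements merged into one kernel-verified Lean document; each statement's English description precedes it below -/
import Mathlib

section
/- Let p ≥ 1, let Θ ⊆ [0,1]^p be convex and compact with Θ_bin := Θ ∩ {0,1}^p nonempty, let Λ ⊆ ℝ^m be nonempty and compact, and let G : ℝ^m × ℝ^p → ℝ be continuous on Λ × Θ with θ ↦ G(λ,θ) L-Lipschitz on Θ (Euclidean norm) for every λ ∈ Λ, where L > 0. Let c ∈ (0, 1/2) and 0 < ε < (1−2c)/L. If (λ̄, θ̄) is a local minimizer on Λ × Θ of (λ,θ) ↦ G(λ,θ) + (1/ε)·φ(θ) (i.e., there is ρ > 0 such that G(λ̄,θ̄) + (1/ε)φ(θ̄) ≤ G(λ,θ) + (1/ε)φ(θ) for all (λ,θ) ∈ Λ × Θ with ‖(λ,θ) − (λ̄,θ̄)‖ ≤ ρ), and if inf_{θ ∈ Θ_bin} ‖θ̄ − θ‖_∞ < c where ‖·‖_∞ is the supremum norm on ℝ^p, then θ̄ ∈ Θ_bin. -/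
open scoped BigOperators

/-- The concave penalty function `φ(θ) = ∑ i, θ i (1 - θ i)`. -/
noncomputable def phi {p : ℕ} (θ : EuclideanSpace ℝ (Fin p)) : ℝ :=
  ∑ i, θ i * (1 - θ i)

/-- The distance from a point to a set measured in the supremum norm. -/
noncomputable def supDist {p : ℕ} (x : EuclideanSpace ℝ (Fin p))
    (S : Set (EuclideanSpace ℝ (Fin p))) : ℝ :=
  sInf ((fun s => ⨆ i, |x i - s i|) '' S)

/-- A point at sup-distance less than `c` from a nonempty set is coordinatewise `c`-close to
some element of the set. -/
lemma exists_forall_abs_sub_lt_of_supDist_lt {p : ℕ} {x : EuclideanSpace ℝ (Fin p)}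
    {S : Set (EuclideanSpace ℝ (Fin p))} (hS : S.Nonempty) {c : ℝ} (h : supDist x S < c) :
    ∃ s ∈ S, ∀ i, |x i - s i| < c := by
  obtain ⟨_, ⟨s, hs, rfl⟩, hlt⟩ := exists_lt_of_csInf_lt (hS.image _) h
  exact ⟨s, hs, fun i => (le_ciSup (Set.finite_range fun i => |x i - s i|).bddAbove i).trans_lt hlt⟩

/-- The Euclidean norm is at most the `ℓ¹` norm. -/
lemma EuclideanSpace.norm_le_sum_abs {ι : Type*} [Fintype ι] (x : EuclideanSpace ℝ ι) :
    ‖x‖ ≤ ∑ i, |x i| := by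
  rw [EuclideanSpace.norm_eq]
  refine Real.sqrt_le_iff.2 ⟨Finset.sum_nonneg fun i _ => abs_nonneg _, ?_⟩
  simpa only [Real.norm_eq_abs] using
    Finset.sum_sq_le_sq_sum_of_nonneg fun i (_ : i ∈ Finset.univ) => abs_nonneg (x i)

/-- Moving from a point of the unit cube towards a binary point that is coordinatewise `c`-close
decreases `phi` at rate at least `1 - 2 * c`. -/
lemma phi_add_smul_sub_le {p : ℕ} {θ b : EuclideanSpace ℝ (Fin p)} {c t : ℝ}
    (hc : c ≤ 1 / 2) (ht : 0 ≤ t) (hθ : ∀ i, θ i ∈ Set.Icc (0 : ℝ) 1)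
    (hb : ∀ i, b i = 0 ∨ b i = 1) (hclose : ∀ i, |θ i - b i| ≤ c) :
    phi (θ + t • (b - θ)) ≤ phi θ - t * (1 - 2 * c) * ‖b - θ‖ := by
  have hcoord : ∀ i, (θ + t • (b - θ)) i * (1 - (θ + t • (b - θ)) i) ≤
      θ i * (1 - θ i) - t * (1 - 2 * c) * |(b - θ) i| := by
    intro i
    simp only [PiLp.add_apply, PiLp.smul_apply, PiLp.sub_apply, smul_eq_mul]
    have hslope : (b i - θ i) * (1 - 2 * θ i) ≤ -((1 - 2 * c) * |b i - θ i|) := by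
      obtain ⟨h0, h1⟩ := hθ i
      have hi := abs_le.1 (hclose i)
      rcases hb i with h | h <;> rw [h] at hi ⊢
      · rw [abs_of_nonpos (by linarith)]
        nlinarith
      · rw [abs_of_nonneg (by linarith)]
        nlinarith
    nlinarith [mul_le_mul_of_nonneg_left hslope ht, sq_nonneg (t * (b i - θ i))]
  calc phi (θ + t • (b - θ))
      ≤ ∑ i, (θ i * (1 - θ i) - t * (1 - 2 * c) * |(b - θ) i|) :=
        Finset.sum_le_sum fun i _ => hcoord i
    _ = phi θ - t * (1 - 2 * c) * ∑ i, |(b - θ) i| := by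
        rw [Finset.sum_sub_distrib, Finset.mul_sum, phi]
    _ ≤ phi θ - t * (1 - 2 * c) * ‖b - θ‖ :=
        sub_le_sub_left (mul_le_mul_of_nonneg_left (EuclideanSpace.norm_le_sum_abs _)
          (mul_nonneg ht (by linarith))) _

/-- If `ε < (1-2c)/L` and `(λ̄, θ̄)` is a local minimizer of `G + (1/ε) φ` on `Λ × Θ`
with `dist_∞(θ̄, Θ_bin) < c`, then `θ̄ ∈ Θ_bin`. -/
theorem local_minimizer_binary {m p : ℕ} (hp : 1 ≤ p)
    (Θ : Set (EuclideanSpace ℝ (Fin p)))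
    (hΘsub : Θ ⊆ {θ | ∀ i, θ i ∈ Set.Icc (0 : ℝ) 1})
    (hΘconv : Convex ℝ Θ) (hΘcomp : IsCompact Θ)
    (Θbin : Set (EuclideanSpace ℝ (Fin p)))
    (hΘbin : Θbin = Θ ∩ {θ | ∀ i, θ i = 0 ∨ θ i = 1})
    (hΘbinne : Θbin.Nonempty)
    (Λ : Set (EuclideanSpace ℝ (Fin m))) (hΛne : Λ.Nonempty) (hΛcomp : IsCompact Λ)
    (G : EuclideanSpace ℝ (Fin m) → EuclideanSpace ℝ (Fin p) → ℝ)
    (hGcont : ContinuousOn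
      (fun x : EuclideanSpace ℝ (Fin m) × EuclideanSpace ℝ (Fin p) => G x.1 x.2) (Λ ×ˢ Θ))
    (L : ℝ) (hL : 0 < L)
    (hLip : ∀ lam ∈ Λ, LipschitzOnWith L.toNNReal (G lam) Θ)
    (c : ℝ) (hc : c ∈ Set.Ioo (0 : ℝ) (1 / 2))
    (ε : ℝ) (hε : 0 < ε) (hεL : ε < (1 - 2 * c) / L)
    (lamBar : EuclideanSpace ℝ (Fin m)) (θBar : EuclideanSpace ℝ (Fin p))
    (hmem : (lamBar, θBar) ∈ Λ ×ˢ Θ)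
    (hlocmin : ∃ ρ > (0 : ℝ), ∀ y ∈ Λ ×ˢ Θ, dist y (lamBar, θBar) ≤ ρ →
      G lamBar θBar + (1 / ε) * phi θBar ≤ G y.1 y.2 + (1 / ε) * phi y.2)
    (hdist : supDist θBar Θbin < c) :
    θBar ∈ Θbin := by
  obtain ⟨b, hbmem, hclose⟩ := exists_forall_abs_sub_lt_of_supDist_lt hΘbinne hdist
  obtain ⟨ρ, hρ, hmin⟩ := hlocmin
  obtain ⟨hlam, hθ⟩ := hmem
  have hb : b ∈ Θ ∧ ∀ i, b i = 0 ∨ b i = 1 := by rwa [hΘbin] at hbmem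
  by_cases hd : b - θBar = 0
  · rwa [← sub_eq_zero.1 hd]
  exfalso
  have hdpos : 0 < ‖b - θBar‖ := norm_pos_iff.2 hd
  set t : ℝ := min 1 (ρ / ‖b - θBar‖) with ht_def
  have ht : 0 < t := lt_min one_pos (div_pos hρ hdpos)
  have hnorm : ‖t • (b - θBar)‖ = t * ‖b - θBar‖ := by
    rw [norm_smul, Real.norm_of_nonneg ht.le]
  have hmem_t : θBar + t • (b - θBar) ∈ Θ :=
    hΘconv.add_smul_sub_mem hθ hb.1 ⟨ht.le, min_le_left _ _⟩
  have hdist_t : dist (θBar + t • (b - θBar)) θBar = t * ‖b - θBar‖ := by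
    rw [dist_self_add_left, hnorm]
  have hle := hmin (lamBar, θBar + t • (b - θBar)) ⟨hlam, hmem_t⟩ <| by
    rw [Prod.dist_eq, dist_self, hdist_t]
    exact max_le hρ.le ((le_div_iff₀ hdpos).1 (min_le_right _ _))
  have hphi := phi_add_smul_sub_le hc.2.le ht.le (hΘsub hθ) hb.2 fun i => (hclose i).le
  have hG : G lamBar (θBar + t • (b - θBar)) - G lamBar θBar ≤ L * (t * ‖b - θBar‖) := by
    have h := (hLip lamBar hlam).dist_le_mul _ hmem_t _ hθ
    rw [Real.coe_toNNReal _ hL.le, hdist_t, Real.dist_eq] at h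
    exact (le_abs_self _).trans h
  have hslope : L < 1 / ε * (1 - 2 * c) := by
    rw [one_div_mul_eq_div, lt_div_iff₀ hε, mul_comm]
    exact (lt_div_iff₀ hL).1 hεL
  have hlt := mul_lt_mul_of_pos_right hslope (mul_pos ht hdpos)
  have hpen := mul_le_mul_of_nonneg_left hphi (one_div_pos.2 hε).le
  dsimp only at hle
  linarith
end

section
/- Let p ≥ 1, let Θ ⊆ [0,1]^p be compact with Θ_bin := Θ ∩ {0,1}^p nonempty, let Λ ⊆ ℝ^m be nonempty and compact, and let G : ℝ^m × ℝ^p → ℝ be continuous on Λ × Θ. Let (ε_k)_{k∈ℕ} be a sequence of positive reals converging to 0, and for each k let (λ^k, θ^k) be a global minimizer over Λ × Θ of (λ,θ) ↦ G(λ,θ) + (1/ε_k)·φ(θ), where φ(θ) = Σ_{i=1}^p θ_i(1−θ_i). Then every cluster point (λ*, θ*) of the sequence ((λ^k, θ^k))_{k∈ℕ} satisfies (λ*, θ*) ∈ Λ × Θ_bin and G(λ*, θ*) = min_{(λ,θ) ∈ Λ × Θ_bin} G(λ,θ). -/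
open scoped BigOperators
open Filter

theorem phi_nonneg {p : ℕ} {θ : EuclideanSpace ℝ (Fin p)}
    (hθ : ∀ i, θ i ∈ Set.Icc (0 : ℝ) 1) : 0 ≤ phi θ :=
  Finset.sum_nonneg fun i _ => mul_nonneg (hθ i).1 (sub_nonneg.2 (hθ i).2)

theorem phi_eq_zero_iff {p : ℕ} {θ : EuclideanSpace ℝ (Fin p)}
    (hθ : ∀ i, θ i ∈ Set.Icc (0 : ℝ) 1) : phi θ = 0 ↔ ∀ i, θ i = 0 ∨ θ i = 1 := by
  rw [phi, Finset.sum_eq_zero_iff_of_nonneg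
    fun i _ => mul_nonneg (hθ i).1 (sub_nonneg.2 (hθ i).2)]
  simp only [Finset.mem_univ, true_imp_iff, mul_eq_zero, sub_eq_zero, eq_comm (a := (1 : ℝ))]

theorem continuous_phi {p : ℕ} : Continuous (phi (p := p)) := by
  unfold phi
  fun_prop

/-- Γ-convergence/equicoercivity remark: if `ε_k → 0` and `(λ^k, θ^k)` globally
minimizes `G + (1/ε_k) φ` over `Λ × Θ`, then every cluster point of the sequence
lies in `Λ × Θ_bin` and globally minimizes `G` over `Λ × Θ_bin`. -/
theorem cluster_point_global_minimizer {m p : ℕ} (hp : 1 ≤ p)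
    (Θ : Set (EuclideanSpace ℝ (Fin p)))
    (hΘsub : Θ ⊆ {θ | ∀ i, θ i ∈ Set.Icc (0 : ℝ) 1}) (hΘcomp : IsCompact Θ)
    (Θbin : Set (EuclideanSpace ℝ (Fin p)))
    (hΘbin : Θbin = Θ ∩ {θ | ∀ i, θ i = 0 ∨ θ i = 1})
    (hΘbinne : Θbin.Nonempty)
    (Λ : Set (EuclideanSpace ℝ (Fin m))) (hΛne : Λ.Nonempty) (hΛcomp : IsCompact Λ)
    (G : EuclideanSpace ℝ (Fin m) → EuclideanSpace ℝ (Fin p) → ℝ)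
    (hGcont : ContinuousOn
      (fun x : EuclideanSpace ℝ (Fin m) × EuclideanSpace ℝ (Fin p) => G x.1 x.2) (Λ ×ˢ Θ))
    (ε : ℕ → ℝ) (hεpos : ∀ k, 0 < ε k) (hεlim : Tendsto ε atTop (nhds 0))
    (lamSeq : ℕ → EuclideanSpace ℝ (Fin m)) (θSeq : ℕ → EuclideanSpace ℝ (Fin p))
    (hmem : ∀ k, (lamSeq k, θSeq k) ∈ Λ ×ˢ Θ)
    (hglobmin : ∀ k, ∀ y ∈ Λ ×ˢ Θ,
      G (lamSeq k) (θSeq k) + (1 / ε k) * phi (θSeq k) ≤ G y.1 y.2 + (1 / ε k) * phi y.2)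
    (lamStar : EuclideanSpace ℝ (Fin m)) (θStar : EuclideanSpace ℝ (Fin p))
    (hcluster : MapClusterPt (lamStar, θStar) atTop (fun k => (lamSeq k, θSeq k))) :
    (lamStar, θStar) ∈ Λ ×ˢ Θbin ∧
      ∀ y ∈ Λ ×ˢ Θbin, G lamStar θStar ≤ G y.1 y.2 := by
  subst hΘbin
  obtain ⟨U, hU, hlim⟩ := mapClusterPt_iff_ultrafilter.1 hcluster
  have hstar : (lamStar, θStar) ∈ Λ ×ˢ Θ :=
    (hΛcomp.isClosed.prod hΘcomp.isClosed).mem_of_tendsto hlim (Eventually.of_forall hmem)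
  have hG : Tendsto (fun k => G (lamSeq k) (θSeq k)) U (nhds (G lamStar θStar)) :=
    (hGcont _ hstar).tendsto.comp
      (tendsto_nhdsWithin_iff.2 ⟨hlim, Eventually.of_forall hmem⟩)
  have hphi : Tendsto (fun k => phi (θSeq k)) U (nhds (phi θStar)) :=
    (continuous_phi.tendsto _).comp hlim.snd_nhds
  have hbound : ∀ y ∈ Λ ×ˢ (Θ ∩ {θ | ∀ i, θ i = 0 ∨ θ i = 1}), ∀ k,
      G (lamSeq k) (θSeq k) + (1 / ε k) * phi (θSeq k) ≤ G y.1 y.2 := by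
    rintro y ⟨hy₁, hy₂, hy₃⟩ k
    simpa [(phi_eq_zero_iff (hΘsub hy₂)).2 hy₃] using hglobmin k y ⟨hy₁, hy₂⟩
  refine ⟨⟨hstar.1, hstar.2, (phi_eq_zero_iff (hΘsub hstar.2)).1 ?_⟩, fun y hy => ?_⟩
  · obtain ⟨θ, hθ⟩ := hΘbinne
    obtain ⟨l, hl⟩ := hΛne
    have hzero : Tendsto (fun k => ε k * (G l θ - G (lamSeq k) (θSeq k))) U (nhds 0) := by
      simpa using (hεlim.mono_left hU).mul (hG.const_sub (G l θ))
    refine le_antisymm (le_of_tendsto_of_tendsto' hphi hzero fun k => ?_)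
      (phi_nonneg (hΘsub hstar.2))
    have h := hbound (l, θ) ⟨hl, hθ⟩ k
    rw [← div_le_iff₀' (hεpos k), div_eq_inv_mul, ← one_div]
    linarith
  · refine le_of_tendsto' hG fun k => ?_
    have h := hbound y hy k
    have := mul_nonneg (one_div_pos.2 (hεpos k)).le (phi_nonneg (hΘsub (hmem k).2))
    linarith
end
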